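/- arXiv:2302.02200 — 8 statements merged into one kernel-verified Lean document; each statement's English description precedes it below -/
import Mathlib

section
/- Let (S, Γ, ≼) and (S', Γ', ≼') be out-ordered digraphs on finite sets, and let ι be a neighborhood-ordinal injection from (S, Γ, ≼) to (S', Γ', ≼'). Then ι is edge-expansive for the linkage (in-sway) weights: (i) if x and z are mutual friends in (S, Γ, ≼), then ι(x) and ι(z) are mutual friends in (S', Γ', ≼'); and (ii) for every pair of mutual friends x, z one has σ({x,z}) ≤ σ'({ι(x), ι(z)}), where σ and σ' denote the in-sway in (S, Γ, ≼) and (S', Γ', ≼') respectively. -/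
/-- `(S, Γ, le)` is an out-ordered digraph: `x ∉ Γ x` and for each `x`,
`le x` is a partial order on `Γ x` (`le x y z` means `y ≼_x z`). -/
def IsOOD {S : Type*} (Γ : S → Set S) (le : S → S → S → Prop) : Prop :=
  (∀ x, x ∉ Γ x) ∧
  (∀ x, ∀ y ∈ Γ x, le x y y) ∧
  (∀ x, ∀ y ∈ Γ x, ∀ z ∈ Γ x, le x y z → le x z y → y = z) ∧
  (∀ x, ∀ y ∈ Γ x, ∀ z ∈ Γ x, ∀ w ∈ Γ x, le x y z → le x z w → le x y w)

/-- `ι` is a neighborhood-ordinal injection. -/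
def IsNOI {S S' : Type*} (Γ : S → Set S) (le : S → S → S → Prop)
    (Γ' : S' → Set S') (le' : S' → S' → S' → Prop) (ι : S → S') : Prop :=
  (∀ x y, y ∈ Γ x → ι y ∈ Γ' (ι x)) ∧
  (∀ x y z, y ∈ Γ x → z ∈ Γ x → le x y z → le' (ι x) (ι y) (ι z)) ∧
  Function.Injective ι ∧
  (∀ x, ∀ w ∈ Γ' (ι x), (∀ u ∈ Γ x, ι u ≠ w) →
    ∀ y ∈ Γ x, le' (ι x) (ι y) w ∧ ι y ≠ w)

/-- The set ℱ(x,z) of "third wheels". -/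
def Fset {S : Type*} (Γ : S → Set S) (x z : S) : Set S :=
  {y | (x ∈ Γ y ∧ z ∈ Γ y) ∨ (y ∈ Γ x ∧ z ∈ Γ y) ∨ (x ∈ Γ y ∧ y ∈ Γ z)}

/-- The set 𝒢(x,z) counted by the in-sway: third wheels `y` with
`y ∈ Γ x → z ≺_x y` and `y ∈ Γ z → x ≺_z y`. -/
def Gset {S : Type*} (Γ : S → Set S) (le : S → S → S → Prop) (x z : S) : Set S :=
  {y ∈ Fset Γ x z |
    (y ∈ Γ x → le x z y ∧ z ≠ y) ∧ (y ∈ Γ z → le z x y ∧ x ≠ y)}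

/-- Let `z` be a friend of `x`, and suppose `z ≺_x y` in case `y` is a friend of `x`. Then the
same holds for the images under a neighborhood-ordinal injection. -/
theorem IsNOI.map_lt_of_mem {S S' : Type*} {Γ : S → Set S} {le : S → S → S → Prop}
    {Γ' : S' → Set S'} {le' : S' → S' → S' → Prop} {ι : S → S'}
    (hι : IsNOI Γ le Γ' le' ι) {x y z : S} (hz : z ∈ Γ x)
    (h : y ∈ Γ x → le x z y ∧ z ≠ y) (hy : ι y ∈ Γ' (ι x)) :
    le' (ι x) (ι z) (ι y) ∧ ι z ≠ ι y := by
  obtain ⟨-, hmono, hinj, hout⟩ := hι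
  by_cases hyx : y ∈ Γ x
  · exact ⟨hmono x z y hz hyx (h hyx).1, hinj.ne (h hyx).2⟩
  · exact hout x (ι y) hy (fun u hu huy => hyx (hinj huy ▸ hu)) z hz

/-- A neighborhood-ordinal injection maps third wheels to third wheels. -/
theorem IsNOI.map_mem_Fset {S S' : Type*} {Γ : S → Set S} {le : S → S → S → Prop}
    {Γ' : S' → Set S'} {le' : S' → S' → S' → Prop} {ι : S → S'}
    (hι : IsNOI Γ le Γ' le' ι) {x y z : S} (hy : y ∈ Fset Γ x z) :
    ι y ∈ Fset Γ' (ι x) (ι z) :=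
  hy.imp (And.imp (hι.1 _ _) (hι.1 _ _))
    (Or.imp (And.imp (hι.1 _ _) (hι.1 _ _)) (And.imp (hι.1 _ _) (hι.1 _ _)))

/-- A neighborhood-ordinal injection is edge-expansive for in-sway:
it preserves mutual friendship and does not decrease the in-sway. -/
theorem stmt0 {S S' : Type*} [Fintype S] [Fintype S']
    (Γ : S → Set S) (le : S → S → S → Prop)
    (Γ' : S' → Set S') (le' : S' → S' → S' → Prop) (ι : S → S')
    (hS : IsOOD Γ le) (hS' : IsOOD Γ' le') (hι : IsNOI Γ le Γ' le' ι) :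
    ∀ x z : S, z ∈ Γ x → x ∈ Γ z →
      (ι z ∈ Γ' (ι x) ∧ ι x ∈ Γ' (ι z)) ∧
      (Gset Γ le x z).ncard ≤ (Gset Γ' le' (ι x) (ι z)).ncard := by
  intro x z hz hx
  refine ⟨⟨hι.1 x z hz, hι.1 z x hx⟩, ?_⟩
  refine Set.ncard_le_ncard_of_injOn ι ?_ hι.2.2.1.injOn (Set.toFinite _)
  rintro y ⟨hF, hyx, hyz⟩
  exact ⟨hι.map_mem_Fset hF, hι.map_lt_of_mem hz hyx, hι.map_lt_of_mem hx hyz⟩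
end

section
/- Let ι be a neighborhood-ordinal injection from an out-ordered digraph (S, Γ, ≼) to an out-ordered digraph (S', Γ', ≼'), and let x, z ∈ S be mutual friends. Then ι maps the set 𝒢_{(S,Γ,≼)}(x,z) into the set 𝒢_{(S',Γ',≼')}(ι(x), ι(z)); that is, for every y ∈ 𝒢_{(S,Γ,≼)}(x,z) one has ι(y) ∈ 𝒢_{(S',Γ',≼')}(ι(x), ι(z)). -/
/-- A neighborhood-ordinal injection preserves the property that `y` is either outside
the neighborhood of `x` or strictly above `z` in it. -/
theorem IsNOI.lt_of_mem {S S' : Type*} {Γ : S → Set S} {le : S → S → S → Prop}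
    {Γ' : S' → Set S'} {le' : S' → S' → S' → Prop} {ι : S → S'}
    (hι : IsNOI Γ le Γ' le' ι) {x y z : S} (hz : z ∈ Γ x)
    (h : y ∈ Γ x → le x z y ∧ z ≠ y) (hy' : ι y ∈ Γ' (ι x)) :
    le' (ι x) (ι z) (ι y) ∧ ι z ≠ ι y := by
  obtain ⟨-, hmono, hinj, htop⟩ := hι
  by_cases hy : y ∈ Γ x
  · exact ⟨hmono x z y hz hy (h hy).1, hinj.ne (h hy).2⟩
  · exact htop x (ι y) hy' (fun u hu huy => hy (hinj huy ▸ hu)) z hz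

/-- A neighborhood-ordinal injection maps `𝒢(x,z)` into `𝒢(ι x, ι z)`
whenever `x` and `z` are mutual friends. -/
theorem stmt2 {S S' : Type*}
    (Γ : S → Set S) (le : S → S → S → Prop)
    (Γ' : S' → Set S') (le' : S' → S' → S' → Prop) (ι : S → S')
    (hS : IsOOD Γ le) (hS' : IsOOD Γ' le') (hι : IsNOI Γ le Γ' le' ι)
    (x z : S) (hxz : z ∈ Γ x) (hzx : x ∈ Γ z) :
    ∀ y ∈ Gset Γ le x z, ι y ∈ Gset Γ' le' (ι x) (ι z) := by
  rintro y ⟨hF, hx, hz⟩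
  refine ⟨?_, hι.lt_of_mem hxz hx, hι.lt_of_mem hzx hz⟩
  exact hF.imp (And.imp (hι.1 _ _) (hι.1 _ _))
    (Or.imp (And.imp (hι.1 _ _) (hι.1 _ _)) (And.imp (hι.1 _ _) (hι.1 _ _)))
end

section
/- Let (S, Γ, ≺) be an out-ordered digraph in which each ≺_x is a strict linear order on Γ(x). Let x, y, z be distinct elements of S such that the 2-simplex {xy, yz, xz} is Γ-pertinent. If the induced orientation of the three 1-simplices of this triangle is not a directed 3-cycle, then at least one pair among {x,y}, {y,z}, {x,z} consists of mutual friends. -/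
/-- `(S, Γ, lt)` is an out-ordered digraph in which each `lt x` is a strict
linear order on `Γ x` (`lt x y z` means `y ≺_x z`), and `x ∉ Γ x`. -/
def IsOODLin {S : Type*} (Γ : S → Set S) (lt : S → S → S → Prop) : Prop :=
  (∀ x, x ∉ Γ x) ∧
  (∀ x, ∀ y ∈ Γ x, ¬ lt x y y) ∧
  (∀ x, ∀ y ∈ Γ x, ∀ z ∈ Γ x, ∀ w ∈ Γ x, lt x y z → lt x z w → lt x y w) ∧
  (∀ x, ∀ y ∈ Γ x, ∀ z ∈ Γ x, y ≠ z → lt x y z ∨ lt x z y)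

/-- `orient Γ lt x y z` means that the 1-simplex between the 0-simplices
`xy` and `xz` (sharing the vertex `x`) is oriented `xy → xz`. -/
def orient {S : Type*} (Γ : S → Set S) (lt : S → S → S → Prop) (x y z : S) : Prop :=
  (y ∈ Γ x ∧ z ∈ Γ x ∧ lt x y z) ∨ (y ∈ Γ x ∧ z ∉ Γ x)

/-- The voter triangle `{xy, yz, xz}` on distinct `x, y, z` is Γ-pertinent:
each pair is an acquaintance pair and each of `Γ(x) ∩ {y,z}`,
`Γ(y) ∩ {x,z}`, `Γ(z) ∩ {x,y}` is nonempty. -/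
def Pertinent {S : Type*} (Γ : S → Set S) (x y z : S) : Prop :=
  (y ∈ Γ x ∨ x ∈ Γ y) ∧ (z ∈ Γ y ∨ y ∈ Γ z) ∧ (z ∈ Γ x ∨ x ∈ Γ z) ∧
  (y ∈ Γ x ∨ z ∈ Γ x) ∧ (x ∈ Γ y ∨ z ∈ Γ y) ∧ (x ∈ Γ z ∨ y ∈ Γ z)

/-- The induced orientation of the voter triangle `{xy, yz, xz}` is a
directed 3-cycle: `xy → yz → xz → xy` or the reverse. -/
def Cycle3 {S : Type*} (Γ : S → Set S) (lt : S → S → S → Prop) (x y z : S) : Prop :=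
  (orient Γ lt y x z ∧ orient Γ lt z y x ∧ orient Γ lt x z y) ∨
  (orient Γ lt y z x ∧ orient Γ lt z x y ∧ orient Γ lt x y z)

/-- In every Γ-pertinent voter triangle whose induced orientation is not a
directed 3-cycle, some pair of its three objects are mutual friends. -/
theorem stmt6 {S : Type*} (Γ : S → Set S) (lt : S → S → S → Prop)
    (h : IsOODLin Γ lt) (x y z : S)
    (hxy : x ≠ y) (hyz : y ≠ z) (hxz : x ≠ z)
    (hp : Pertinent Γ x y z) (hc : ¬ Cycle3 Γ lt x y z) :
    (y ∈ Γ x ∧ x ∈ Γ y) ∨ (z ∈ Γ y ∧ y ∈ Γ z) ∨ (z ∈ Γ x ∧ x ∈ Γ z) := by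
  unfold Pertinent at hp
  unfold Cycle3 orient at hc
  tauto
end

section
/- Let (S, Γ, ≺) be an out-ordered digraph on a finite set with n elements in which each ≺_x is a strict linear order on Γ(x), such that |Γ(x)| ≤ K for all x ∈ S and no Γ-pertinent 2-simplex has a directed 3-cycle as its induced orientation (3-concordance). Then the number of Γ-pertinent 2-simplices, i.e., of 3-element subsets {x, y, z} of S satisfying the Γ-pertinence conditions, is at most n·K². -/
/-- Every pertinent triangle contains a directed path of length two through its three vertices. -/
lemma Pertinent.exists_path {S : Type*} [DecidableEq S] {Γ : S → Set S} {x y z : S}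
    (h : Pertinent Γ x y z) :
    ∃ a b c : S, b ∈ Γ a ∧ c ∈ Γ b ∧ ({x, y, z} : Finset S) = {a, b, c} := by
  obtain ⟨hxy, -, -, hx, hy, hz⟩ := h
  have swap : ∀ a b c : S, ({a, b, c} : Finset S) = {b, a, c} := fun a b c =>
    Finset.insert_comm a b {c}
  have rot : ∀ a b c : S, ({a, b, c} : Finset S) = {b, c, a} := fun a b c => by
    rw [swap, Finset.pair_comm]
  by_cases hyx : y ∈ Γ x
  · by_cases hzy : z ∈ Γ y
    · exact ⟨x, y, z, hyx, hzy, rfl⟩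
    · have hxy' : x ∈ Γ y := hy.resolve_right hzy
      rcases hz with hz | hz
      · exact ⟨z, x, y, hz, hyx, (rot z x y).symm⟩
      · exact ⟨z, y, x, hz, hxy', by rw [rot z y x, swap]⟩
  · have hxy' : x ∈ Γ y := hxy.resolve_left hyx
    exact ⟨y, x, z, hxy', hx.resolve_left hyx, swap x y z⟩

/-- If all out-degrees are at most `K`, there are at most `|S| * K²` directed paths `a → b → c`. -/
lemma card_paths_le {S : Type*} [Fintype S] (N : S → Finset S) (K : ℕ)
    (hN : ∀ x, (N x).card ≤ K) :
    (Finset.univ.sigma fun a : S => (N a).sigma fun b => N b).card ≤ Fintype.card S * K ^ 2 := by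
  rw [Finset.card_sigma, ← Finset.card_univ, ← smul_eq_mul]
  refine Finset.sum_le_card_nsmul _ _ _ fun a _ => ?_
  rw [Finset.card_sigma]
  calc ∑ b ∈ N a, (N b).card ≤ (N a).card • K := Finset.sum_le_card_nsmul _ _ _ fun b _ => hN b
    _ ≤ K ^ 2 := by rw [smul_eq_mul, sq]; exact Nat.mul_le_mul_right K (hN a)

/-- In a 3-concordant out-ordered digraph on `n` objects with `|Γ x| ≤ K`,
the number of Γ-pertinent 2-simplices (3-element subsets `{x,y,z}` satisfying
the Γ-pertinence conditions) is at most `n * K²`. -/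
theorem stmt8 {S : Type*} [Fintype S] [DecidableEq S]
    (Γ : S → Set S) (lt : S → S → S → Prop) (h : IsOODLin Γ lt)
    (n K : ℕ) (hn : Fintype.card S = n)
    (hK : ∀ x, (Γ x).ncard ≤ K)
    (hconc : ∀ x y z : S, x ≠ y → y ≠ z → x ≠ z →
      Pertinent Γ x y z → ¬ Cycle3 Γ lt x y z) :
    {T : Finset S | ∃ x y z : S, x ≠ y ∧ y ≠ z ∧ x ≠ z ∧
      T = {x, y, z} ∧ Pertinent Γ x y z}.ncard ≤ n * K ^ 2 := by
  classical
  subst hn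
  set P := Finset.univ.sigma fun a : S => (Γ a).toFinset.sigma fun b => (Γ b).toFinset
  have hP : P.card ≤ Fintype.card S * K ^ 2 :=
    card_paths_le _ K fun x => by rw [← Set.ncard_eq_toFinset_card']; exact hK x
  refine le_trans ?_ (Finset.card_image_le (f := fun p => ({p.1, p.2.1, p.2.2} : Finset S)) |>.trans
    hP)
  rw [← Set.ncard_coe_finset]
  refine Set.ncard_le_ncard ?_ (Finset.finite_toSet _)
  rintro T ⟨x, y, z, -, -, -, rfl, hT⟩
  obtain ⟨a, b, c, hb, hc, habc⟩ := hT.exists_path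
  exact Finset.mem_coe.2 <| Finset.mem_image.2 ⟨⟨a, b, c⟩, by simp [P, hb, hc], habc.symm⟩
end

section
/- Let S be a finite set with n elements and let r be a ranking table on S, i.e., for each i ∈ S a function r_i : S → {0, 1, …, n−1} with r_i(i) = 0 and with r_i restricting to a bijection from S ∖ {i} onto {1, …, n−1}. Suppose r is 3-concordant: there are no distinct i, j, k with r_i(j) < r_i(k), r_j(k) < r_j(i), and r_k(i) < r_k(j). Fix i ∈ S and distinct j, k ∈ S ∖ {i} with r_i(k) = r_i(j) + 1, and let r' be the ranking table obtained from r by exchanging the values r_i(j) and r_i(k) (all other entries unchanged; this is a consecutive transposition). If it is NOT the case that both r_j(i) < r_j(k) and r_k(j) < r_k(i), then r' is also 3-concordant. -/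
/-- `r` is a ranking table on the finite set `S`: `r i i = 0` and `r i`
restricts to a bijection from `S \ {i}` onto `{1, …, n-1}`. -/
def IsRankingTable {S : Type*} [Fintype S] (r : S → S → ℕ) : Prop :=
  (∀ i, r i i = 0) ∧
  ∀ i, Set.BijOn (r i) {j | j ≠ i} (Set.Icc 1 (Fintype.card S - 1))

/-- `r` is 3-concordant: no distinct `i, j, k` with `r i j < r i k`,
`r j k < r j i`, and `r k i < r k j`. -/
def TableThreeConcordant {S : Type*} (r : S → S → ℕ) : Prop :=
  ∀ i j k : S, i ≠ j → j ≠ k → i ≠ k →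
    ¬(r i j < r i k ∧ r j k < r j i ∧ r k i < r k j)

/-- A consecutive transposition of a 3-concordant ranking table remains
3-concordant, unless `r j i < r j k` and `r k j < r k i` both hold. -/
theorem stmt14 {S : Type*} [Fintype S] (r r' : S → S → ℕ)
    (hrt : IsRankingTable r) (hconc : TableThreeConcordant r)
    (i j k : S) (hij : i ≠ j) (hik : i ≠ k) (hjk : j ≠ k)
    (hcons : r i k = r i j + 1)
    (h'j : r' i j = r i k) (h'k : r' i k = r i j)
    (h'other : ∀ a b : S, ¬(a = i ∧ (b = j ∨ b = k)) → r' a b = r a b)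
    (hnot : ¬(r j i < r j k ∧ r k j < r k i)) :
    TableThreeConcordant r' := by
  have hinj : ∀ b c : S, b ≠ i → c ≠ i → r i b = r i c → b = c :=
    fun b c hb hc h => (hrt.2 i).injOn hb hc h
  have hrow : ∀ a : S, a ≠ i → ∀ b, r' a b = r a b :=
    fun a ha b => h'other a b fun h => ha h.1
  have hoth : ∀ b : S, b ≠ j → b ≠ k → r' i b = r i b :=
    fun b hj hk => h'other i b fun h => h.2.elim hj hk
  have hlt : ∀ a b c : S, a ≠ b → a ≠ c → r' a b < r' a c →
      r a b < r a c ∨ (a = i ∧ b = k ∧ c = j) := by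
    intro a b c hab hac h
    by_cases ha : a = i
    · subst ha
      have hbj := hinj b j hab.symm hij.symm
      have hck := hinj c k hac.symm hik.symm
      have hb := hoth b
      have hc := hoth c
      by_cases b = j <;> by_cases b = k <;> by_cases c = j <;> by_cases c = k <;> grind
    · rw [hrow a ha, hrow a ha] at h
      exact Or.inl h
  rintro a b c hab hbc hac ⟨h1, h2, h3⟩
  rcases hlt a b c hab hac h1 with g1 | ⟨rfl, rfl, rfl⟩
  · rcases hlt b c a hbc hab.symm h2 with g2 | ⟨rfl, rfl, rfl⟩
    · rcases hlt c a b hac.symm hbc.symm h3 with g3 | ⟨rfl, rfl, rfl⟩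
      · exact hconc a b c hab hbc hac ⟨g1, g2, g3⟩
      · grind
    · grind
  · grind
end

section
/- The number of 3-concordant ranking systems on a 4-element set is exactly 450. That is, among all assignments to each element x of a 4-element set S of a strict linear order ≺_x on S ∖ {x} (there are 6⁴ = 1296 such assignments), exactly 450 have the property that no three distinct elements x, y, z satisfy x ≺_y z, y ≺_z x, and z ≺_x y. -/
/-- `lt` encodes a ranking system on the 4-element set `Fin 4`:
`lt x y z = true` means `y ≺_x z`; for each `x`, `lt x` is a strict linear
order on `Fin 4 \ {x}` (and holds only for arguments distinct from `x` and
from each other). -/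
def IsRankSys (lt : Fin 4 → Fin 4 → Fin 4 → Bool) : Prop :=
  (∀ x y z : Fin 4, lt x y z = true → y ≠ x ∧ z ≠ x ∧ y ≠ z) ∧
  (∀ x y z w : Fin 4, lt x y z = true → lt x z w = true → lt x y w = true) ∧
  (∀ x y z : Fin 4, y ≠ x → z ≠ x → y ≠ z → (lt x y z = true ∨ lt x z y = true)) ∧
  (∀ x y z : Fin 4, lt x y z = true → lt x z y = false)

/-- `lt` is 3-concordant: no three distinct elements `x, y, z` satisfy
`x ≺_y z`, `y ≺_z x`, and `z ≺_x y`. -/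
def ThreeConc (lt : Fin 4 → Fin 4 → Fin 4 → Bool) : Prop :=
  ∀ x y z : Fin 4, x ≠ y → y ≠ z → x ≠ z →
    ¬(lt y x z = true ∧ lt z y x = true ∧ lt x z y = true)

instance : DecidablePred IsRankSys := fun lt => by
  unfold IsRankSys; infer_instance

instance : DecidablePred ThreeConc := fun lt => by
  unfold ThreeConc; infer_instance

/-- The relation on the elements other than `x` whose values on the three pairs of such elements,
listed lexicographically, are `c 0`, `c 1`, `c 2`. -/
def rowOfBits (x : Fin 4) (c : Fin 3 → Bool) : Fin 4 → Fin 4 → Bool :=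
  (![![![false, false, false, false], ![false, false, c 0, c 1],
      ![false, !c 0, false, c 2], ![false, !c 1, !c 2, false]],
    ![![false, false, c 0, c 1], ![false, false, false, false],
      ![!c 0, false, false, c 2], ![!c 1, false, !c 2, false]],
    ![![false, c 0, false, c 1], ![!c 0, false, false, c 2],
      ![false, false, false, false], ![!c 1, !c 2, false, false]],
    ![![false, c 0, c 1, false], ![!c 0, false, c 2, false],
      ![!c 1, !c 2, false, false], ![false, false, false, false]]] :
    Fin 4 → Fin 4 → Fin 4 → Bool) x

/-- The relation family whose relation at `x` has the bits `b x`. -/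
def sysOfBits (b : Fin 4 → Fin 3 → Bool) : Fin 4 → Fin 4 → Fin 4 → Bool :=
  fun x => rowOfBits x (b x)

/-- The bit patterns of the strict linear orders on three elements. -/
def linearBits : Finset (Fin 3 → Bool) :=
  Finset.univ.filter fun c => c 0 = c 2 → c 0 = c 1

/-- The comparisons made by a relation family, one for each pair of other elements. -/
def bitsOfSys (lt : Fin 4 → Fin 4 → Fin 4 → Bool) : Fin 4 → Fin 3 → Bool :=
  ![![lt 0 1 2, lt 0 1 3, lt 0 2 3], ![lt 1 0 2, lt 1 0 3, lt 1 2 3],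
    ![lt 2 0 1, lt 2 0 3, lt 2 1 3], ![lt 3 0 1, lt 3 0 2, lt 3 1 2]]

lemma bitsOfSys_sysOfBits (b : Fin 4 → Fin 3 → Bool) : bitsOfSys (sysOfBits b) = b := by
  ext x i
  fin_cases x <;> fin_cases i <;> rfl

lemma IsRankSys.eq_not {lt : Fin 4 → Fin 4 → Fin 4 → Bool} (h : IsRankSys lt) {x y z : Fin 4}
    (hy : y ≠ x) (hz : z ≠ x) (hyz : y ≠ z) : lt x y z = !lt x z y := by
  have h₁ := h.2.2.1 x y z hy hz hyz
  have h₂ := h.2.2.2 x y z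
  cases h₃ : lt x y z <;> simp_all

lemma IsRankSys.eq_false {lt : Fin 4 → Fin 4 → Fin 4 → Bool} (h : IsRankSys lt) {x y z : Fin 4}
    (hxyz : y = x ∨ z = x ∨ y = z) : lt x y z = false := by
  have h₁ := h.1 x y z
  rw [Bool.eq_false_iff]
  tauto

lemma IsRankSys.sysOfBits_bitsOfSys {lt : Fin 4 → Fin 4 → Fin 4 → Bool} (h : IsRankSys lt) :
    sysOfBits (bitsOfSys lt) = lt := by
  ext x y z
  fin_cases x <;> fin_cases y <;> fin_cases z <;>
    first
    | rfl
    | exact (h.eq_false (by decide)).symm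
    | exact (h.eq_not (by decide) (by decide) (by decide)).symm

lemma rowOfBits_order (x : Fin 4) (c : Fin 3 → Bool) :
    (∀ y z, rowOfBits x c y z = true → y ≠ x ∧ z ≠ x ∧ y ≠ z) ∧
    (∀ y z, y ≠ x → z ≠ x → y ≠ z → (rowOfBits x c y z = true ∨ rowOfBits x c z y = true)) ∧
    (∀ y z, rowOfBits x c y z = true → rowOfBits x c z y = false) := by
  revert x c
  decide +kernel

lemma rowOfBits_trans_iff (x : Fin 4) (c : Fin 3 → Bool) :
    (∀ y z w, rowOfBits x c y z = true → rowOfBits x c z w = true → rowOfBits x c y w = true) ↔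
      c ∈ linearBits := by
  revert x c
  decide +kernel

lemma isRankSys_sysOfBits_iff (b : Fin 4 → Fin 3 → Bool) :
    IsRankSys (sysOfBits b) ↔ b ∈ Fintype.piFinset fun _ => linearBits := by
  rw [Fintype.mem_piFinset]
  exact ⟨fun h x => (rowOfBits_trans_iff x (b x)).1 (h.2.1 x),
    fun h => ⟨fun x => (rowOfBits_order x (b x)).1, fun x => (rowOfBits_trans_iff x (b x)).2 (h x),
    fun x => (rowOfBits_order x (b x)).2.1, fun x => (rowOfBits_order x (b x)).2.2⟩⟩

lemma card_filter_univ_eq_card {α β : Type*} [Fintype α] {p : α → Prop} [DecidablePred p]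
    {t : Finset β} {f : α → β} {g : β → α} (hgf : ∀ a, p a → g (f a) = a)
    (hfg : ∀ b, f (g b) = b) (hp : ∀ b, p (g b) ↔ b ∈ t) :
    (Finset.univ.filter p).card = t.card := by
  refine Finset.card_nbij' f g (fun a ha => ?_) (fun b hb => ?_) (fun a ha => ?_) fun b _ => hfg b
  · rw [Finset.mem_coe, Finset.mem_filter_univ] at ha
    rwa [Finset.mem_coe, ← hp, hgf a ha]
  · rwa [Finset.mem_coe, Finset.mem_filter_univ, hp]
  · rw [Finset.mem_coe, Finset.mem_filter_univ] at ha
    exact hgf a ha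

lemma card_filter_isRankSys (p : (Fin 4 → Fin 4 → Fin 4 → Bool) → Prop) [DecidablePred p] :
    (Finset.univ.filter fun lt => IsRankSys lt ∧ p lt).card =
      ((Fintype.piFinset fun _ => linearBits).filter fun b => p (sysOfBits b)).card :=
  card_filter_univ_eq_card (fun _ h => h.1.sysOfBits_bitsOfSys) bitsOfSys_sysOfBits fun b => by
    rw [Finset.mem_filter, isRankSys_sysOfBits_iff]

/-- There are exactly 6⁴ = 1296 ranking systems on a 4-element set, and
exactly 450 of them are 3-concordant. -/
theorem stmt16 :
    (Finset.univ.filter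
      (fun lt : Fin 4 → Fin 4 → Fin 4 → Bool => IsRankSys lt)).card = 1296 ∧
    (Finset.univ.filter
      (fun lt : Fin 4 → Fin 4 → Fin 4 → Bool =>
        IsRankSys lt ∧ ThreeConc lt)).card = 450 := by
  constructor
  · have h := card_filter_isRankSys fun _ => True
    simp only [and_true, Finset.filter_true, Fintype.card_piFinset] at h
    rw [h]
    decide +kernel
  · rw [card_filter_isRankSys]
    decide +kernel
end

section
/- Among the 450 3-concordant ranking systems on the 4-element set {0, 1, 2, 3}, exactly 8 are such that the 4-loop of 0-simplices {0,1}, {1,2}, {2,3}, {3,0} is a directed 4-cycle in the induced orientation of the line graph, in forward or reverse order; i.e., exactly 8 systems satisfy either (0 ≺₁ 2 and 1 ≺₂ 3 and 2 ≺₃ 0 and 3 ≺₀ 1) or (2 ≺₁ 0 and 3 ≺₂ 1 and 0 ≺₃ 2 and 1 ≺₀ 3). -/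
/-- The ranking system on `Fin 4` in which every `x` ranks its two neighbours on the 4-loop in the
order given by `d` (`x + 1` first if `d` holds, `x + 3` first otherwise), and ranks its antipode
`x + 2` last or first according to `a` (for even `x`) or `b` (for odd `x`). -/
def antipodalSystem (p : Bool × Bool × Bool) (x y z : Fin 4) : Bool :=
  let last := if x = 0 ∨ x = 2 then p.2.1 else p.2.2
  decide (y ≠ x ∧ z ≠ x ∧ y ≠ z) &&
    if z = x + 2 then last else if y = x + 2 then !last
    else if p.1 then decide (y = x + 1) else decide (y = x + 3)

theorem antipodalSystem_apply {d : Bool} {e : Fin 4} (he : e = if d then 1 else 3) (a b : Bool)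
    (x : Fin 4) :
    antipodalSystem (d, a, b) x (x + e) (x - e) = true ∧
      antipodalSystem (d, a, b) x (x - e) (x + e) = false ∧
      antipodalSystem (d, a, b) x (x + e) (x + 2) = (if x = 0 ∨ x = 2 then a else b) ∧
      antipodalSystem (d, a, b) x (x - e) (x + 2) = (if x = 0 ∨ x = 2 then a else b) ∧
      antipodalSystem (d, a, b) x (x + 2) (x + e) = !(if x = 0 ∨ x = 2 then a else b) ∧
      antipodalSystem (d, a, b) x (x + 2) (x - e) = !(if x = 0 ∨ x = 2 then a else b) := by
  subst he
  revert d a b x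
  decide

theorem antipodalSystem_injective : Function.Injective antipodalSystem := by
  intro p q h
  have hd := congrFun (congrFun (congrFun h 0) 1) 3
  have ha := congrFun (congrFun (congrFun h 0) 1) 2
  have hb := congrFun (congrFun (congrFun h 1) 2) 3
  revert p q
  decide

theorem isRankSys_antipodalSystem (p : Bool × Bool × Bool) : IsRankSys (antipodalSystem p) := by
  revert p
  unfold IsRankSys
  decide +kernel

theorem threeConc_antipodalSystem (p : Bool × Bool × Bool) : ThreeConc (antipodalSystem p) := by
  revert p
  unfold ThreeConc
  decide +kernel

/-- If the 4-loop `x, u, w, v` is a directed 4-cycle of a 3-concordant ranking system, then `x` ranks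
its antipode `w` either first or last, and `w` ranks `x` in the same way. -/
theorem IsRankSys.lt_antipode {lt : Fin 4 → Fin 4 → Fin 4 → Bool} (h : IsRankSys lt)
    (hc : ThreeConc lt) {x u w v : Fin 4} (hx : lt x u v = true) (hu : lt u w x = true)
    (hw : lt w v u = true) (hv : lt v x w = true) :
    lt x v w = lt x u w ∧ lt w u x = lt x u w ∧ lt w v x = lt x u w ∧
      lt x w u = !lt x u w ∧ lt x w v = !lt x u w := by
  obtain ⟨hne, htrans, htotal, hasymm⟩ := h
  obtain ⟨hux, hvx, huv⟩ := hne _ _ _ hx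
  obtain ⟨hwu, -, hwx⟩ := hne _ _ _ hu
  obtain ⟨hvw, -, -⟩ := hne _ _ _ hw
  have total_eq : ∀ {a b c : Fin 4}, b ≠ a → c ≠ a → b ≠ c → lt a c b = !lt a b c := by
    intro a b c hb hc hbc
    have := htotal a b c hb hc hbc
    have := hasymm a b c
    cases h1 : lt a b c <;> simp_all
  have e1 := total_eq hux hwx hwu.symm
  have e2 := total_eq hvx hwx hvw
  have e3 := total_eq hwu.symm hwx.symm hux
  have e4 := total_eq hvw hwx.symm hvx
  have t1 := htrans x u v w hx
  have t2 := htrans w v u x hw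
  have c1 := hc x u w hux.symm hwu.symm hwx.symm
  have c2 := hc x w u hwx.symm hwu hux.symm
  have c3 := hc x v w hvx.symm hvw hwx.symm
  have c4 := hc x w v hwx.symm hvw.symm hvx.symm
  grind

theorem IsRankSys.exists_eq_antipodalSystem {lt : Fin 4 → Fin 4 → Fin 4 → Bool}
    (h : IsRankSys lt) (hc : ThreeConc lt) {d : Bool} {e : Fin 4} (he : e = if d then 1 else 3)
    (hl : ∀ x, lt x (x + e) (x - e) = true) :
    ∃ p, antipodalSystem p = lt := by
  have hadd : ∀ x, x + e + e = x + 2 ∧ x - e + e = x ∧ x - e - e = x + 2 ∧ x + e - e = x ∧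
      x + 2 + e = x - e ∧ x + 2 - e = x + e := by
    clear hl; subst he; revert d; decide
  have hant (x : Fin 4) := h.lt_antipode hc (hl x) (w := x + 2)
    (by simpa [hadd] using hl (x + e)) (by simpa [hadd] using hl (x + 2))
    (by simpa [hadd] using hl (x - e))
  have hlast : ∀ x, lt x (x + e) (x + 2) =
      if x = 0 ∨ x = 2 then lt 0 (0 + e) (0 + 2) else lt 1 (1 + e) (1 + 2) := by
    intro x
    have h0 := (hant 0).2.2.1
    have h1 := (hant 1).2.2.1
    have h2 := (hadd 0).2.2.2.2.1
    have h3 := (hadd 1).2.2.2.2.1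
    fin_cases x
    · rfl
    · rfl
    · simpa [← h2] using h0
    · simpa [← h3] using h1
  refine ⟨(d, lt 0 (0 + e) (0 + 2), lt 1 (1 + e) (1 + 2)), ?_⟩
  generalize lt 0 (0 + e) (0 + 2) = a, lt 1 (1 + e) (1 + 2) = b at hlast
  funext x y z
  by_cases hn : y ≠ x ∧ z ≠ x ∧ y ≠ z
  · obtain ⟨h1, -, -, h2, h3⟩ := hant x
    rw [hlast x] at h1 h2 h3
    have hmem : ∀ w, w ≠ x → w = x + e ∨ w = x - e ∨ w = x + 2 := by
      clear * - he
      subst he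
      revert d x
      decide
    obtain ⟨v1, v2, v3, v4, v5, v6⟩ := antipodalSystem_apply he a b x
    rcases hmem y hn.1 with rfl | rfl | rfl <;> rcases hmem z hn.2.1 with rfl | rfl | rfl
    · exact absurd rfl hn.2.2
    · rw [v1, hl x]
    · rw [v3, hlast x]
    · rw [v2, h.2.2.2 _ _ _ (hl x)]
    · exact absurd rfl hn.2.2
    · rw [v4, h1]
    · rw [v5, h2]
    · rw [v6, h3]
    · exact absurd rfl hn.2.2
  · rw [Bool.eq_false_iff.2 fun ht => hn (h.1 x y z ht)]
    simp [antipodalSystem, hn]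

/-- Among the 450 3-concordant ranking systems on `{0,1,2,3}`, exactly 8 have
the 4-loop `{0,1}, {1,2}, {2,3}, {3,0}` as a directed 4-cycle of the induced
orientation of the line graph, in forward or reverse order. -/
theorem stmt17 :
    (Finset.univ.filter
      (fun lt : Fin 4 → Fin 4 → Fin 4 → Bool =>
        IsRankSys lt ∧ ThreeConc lt ∧
        ((lt 1 0 2 = true ∧ lt 2 1 3 = true ∧ lt 3 2 0 = true ∧
            lt 0 3 1 = true) ∨
         (lt 1 2 0 = true ∧ lt 2 3 1 = true ∧ lt 3 0 2 = true ∧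
            lt 0 1 3 = true)))).card = 8 := by
  rw [show (8 : ℕ) = (Finset.univ.image antipodalSystem).card by
    rw [Finset.card_image_of_injective _ antipodalSystem_injective]; rfl]
  refine congrArg Finset.card (Finset.ext fun lt => ?_)
  simp only [Finset.mem_filter, Finset.mem_univ, true_and, Finset.mem_image]
  constructor
  · rintro ⟨h, hc, hl⟩
    rcases hl with ⟨h1, h2, h3, h0⟩ | ⟨h1, h2, h3, h0⟩
    · refine h.exists_eq_antipodalSystem hc (d := false) rfl fun x => ?_
      fin_cases x <;> assumption
    · refine h.exists_eq_antipodalSystem hc (d := true) rfl fun x => ?_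
      fin_cases x <;> assumption
  · rintro ⟨p, rfl⟩
    refine ⟨isRankSys_antipodalSystem p, threeConc_antipodalSystem p, ?_⟩
    revert p
    decide
end

section
/- There exist two orientations ω and ω' of the line graph of the complete graph K₄ on 4 vertices (the octahedron on the six unordered pairs), each 3-concordant in the sense that no triangle of the line graph is a directed 3-cycle, such that for every edge e of the line graph on which ω and ω' disagree, reversing the direction that ω assigns to e alone produces an orientation in which some triangle of the line graph is a directed 3-cycle. (Hence the single-edge-flip connectivity argument of Fukuda–Prodon–Sakuma for acyclic orientations fails for 3-concordant orientations.) -/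
/-- `d` encodes an orientation of the line graph of `K₄` on `Fin 4`:
`d x y z = true` means the line-graph edge between the 0-simplices `{x,y}`
and `{x,z}` (sharing `x`) is directed `{x,y} → {x,z}`. Exactly one of the
two directions holds on each edge, and `d` holds only for distinct
arguments. -/
def IsOrientation (d : Fin 4 → Fin 4 → Fin 4 → Bool) : Prop :=
  (∀ x y z : Fin 4, d x y z = true → x ≠ y ∧ x ≠ z ∧ y ≠ z) ∧
  (∀ x y z : Fin 4, x ≠ y → x ≠ z → y ≠ z → d x y z = !d x z y)

/-- The orientation `d` is 3-concordant: no triangle of the line graph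
(enforcer triangle `{vx, vy, vz}` or voter triangle `{xy, yz, xz}`) is a
directed 3-cycle. -/
def NoCyclicTriangle (d : Fin 4 → Fin 4 → Fin 4 → Bool) : Prop :=
  (∀ v x y z : Fin 4, v ≠ x → v ≠ y → v ≠ z → x ≠ y → y ≠ z → x ≠ z →
    ¬(d v x y = true ∧ d v y z = true ∧ d v z x = true)) ∧
  (∀ x y z : Fin 4, x ≠ y → y ≠ z → x ≠ z →
    ¬(d y x z = true ∧ d z y x = true ∧ d x z y = true))

/-- Reversing the direction of the single line-graph edge between `{x,y}`
and `{x,z}` in the orientation `d`. -/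
def flipEdge (d : Fin 4 → Fin 4 → Fin 4 → Bool) (x y z : Fin 4) :
    Fin 4 → Fin 4 → Fin 4 → Bool :=
  fun a b c =>
    if a = x ∧ ((b = y ∧ c = z) ∨ (b = z ∧ c = y)) then !d a b c else d a b c

instance (d : Fin 4 → Fin 4 → Fin 4 → Bool) : Decidable (IsOrientation d) := by
  unfold IsOrientation
  infer_instance

set_option synthInstance.maxHeartbeats 400000 in
set_option synthInstance.maxSize 1000 in
instance (d : Fin 4 → Fin 4 → Fin 4 → Bool) : Decidable (NoCyclicTriangle d) := by
  unfold NoCyclicTriangle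
  infer_instance

/-- The direction function whose arrows `{x,y} → {x,z}` are the triples `(x, y, z)` in `l`. -/
def ofArrows (l : List (Fin 4 × Fin 4 × Fin 4)) (x y z : Fin 4) : Bool :=
  decide ((x, y, z) ∈ l)

/-- A 3-concordant orientation in which each of the four edges at `{0,1}` is blocked: reversing it
alone creates a directed 3-cycle. -/
def stuckOrientation : Fin 4 → Fin 4 → Fin 4 → Bool := ofArrows
  [(0, 2, 1), (0, 3, 1), (0, 3, 2), (1, 2, 0), (1, 2, 3), (1, 3, 0),
   (2, 0, 1), (2, 3, 0), (2, 3, 1), (3, 1, 0), (3, 2, 0), (3, 2, 1)]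

/-- A 3-concordant orientation that differs from `stuckOrientation` exactly on the four edges
`{{0,1},{0,2}}`, `{{0,1},{0,3}}`, `{{0,1},{1,2}}` and `{{0,1},{1,3}}`. -/
def targetOrientation : Fin 4 → Fin 4 → Fin 4 → Bool := ofArrows
  [(0, 1, 2), (0, 1, 3), (0, 3, 2), (1, 0, 2), (1, 0, 3), (1, 2, 3),
   (2, 0, 1), (2, 3, 0), (2, 3, 1), (3, 1, 0), (3, 2, 0), (3, 2, 1)]

/-- There exist two distinct 3-concordant orientations of the line graph of
`K₄` (the octahedron) such that reversing any single edge on which they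
disagree destroys 3-concordance: the single-edge-flip connectivity argument
of Fukuda–Prodon–Sakuma fails for 3-concordant orientations. -/
theorem stmt19 :
    ∃ ω ω' : Fin 4 → Fin 4 → Fin 4 → Bool,
      IsOrientation ω ∧ IsOrientation ω' ∧
      NoCyclicTriangle ω ∧ NoCyclicTriangle ω' ∧
      (∃ x y z : Fin 4, x ≠ y ∧ x ≠ z ∧ y ≠ z ∧ ω x y z ≠ ω' x y z) ∧
      (∀ x y z : Fin 4, x ≠ y → x ≠ z → y ≠ z → ω x y z ≠ ω' x y z →
        ¬ NoCyclicTriangle (flipEdge ω x y z)) := by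
  refine ⟨stuckOrientation, targetOrientation, by decide, by decide, ?_, ?_,
    ⟨0, 1, 2, by decide⟩, ?_⟩ <;> decide +kernel
end
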